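/- Let $\mathcal{F}_1, \dots, \mathcal{F}_m \subseteq \binom{[n]}{k}$ be $s$-overlapping families with $n \geq (s+1)k$ and $m \geq s+1$. Then $\sum_{i=1}^m |\mathcal{F}_i| \leq \max\left\{ s\binom{n}{k},\ ms\binom{n-1}{k-1} \right\}$. -/

import Mathlib

/-- Two starting points of arcs of length `k` on the `n`-cycle are far if the arcs are disjoint. -/
def Far (n k a b : ℕ) : Prop :=
  (a + k ≤ b ∧ b + k ≤ a + n) ∨ (b + k ≤ a ∧ a + k ≤ b + n)

lemma mod_cases (n a c : ℕ) (ha : a < n) (hc : c < n) :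
    ((a + c) % n = a + c ∧ a + c < n) ∨ ((a + c) % n + n = a + c) := by
  by_cases h : a + c < n
  · left; exact ⟨Nat.mod_eq_of_lt h, h⟩
  · right
    rw [Nat.mod_eq_sub_mod (by omega), Nat.mod_eq_of_lt (by omega)]; omega

lemma Far.rot {n k a b c : ℕ} (h : Far n k a b) (ha : a < n) (hb : b < n) (hc : c < n) :
    Far n k ((a + c) % n) ((b + c) % n) := by
  unfold Far at *
  rcases mod_cases n a c ha hc with h1 | h1 <;> rcases mod_cases n b c hb hc with h2 | h2 <;> omega

lemma rot_card (n y : ℕ) (hy : y < n) (G : Finset ℕ) (hG : G ⊆ Finset.range n) :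
    ((Finset.range n).filter (fun c => (y + c) % n ∈ G)).card = G.card := by
  have hi : ∀ z, z < n → (z + (n - y)) % n < n ∧ (y + (z + (n - y)) % n) % n = z := by
    intro z hz
    refine ⟨Nat.mod_lt _ (by omega), ?_⟩
    rw [Nat.add_mod_mod, show y + (z + (n - y)) = z + n by omega, Nat.add_mod_right,
      Nat.mod_eq_of_lt hz]
  refine Finset.card_nbij' (fun c => (y + c) % n) (fun z => (z + (n - y)) % n) ?_ ?_ ?_ ?_
  · intro c hc
    simp only [Finset.coe_filter, Set.mem_ofPred_eq] at hc
    exact hc.2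
  · intro z hz
    have hz' := Finset.mem_range.1 (hG hz)
    simp only [Finset.coe_filter, Set.mem_ofPred_eq, Finset.mem_range]
    refine ⟨(hi z hz').1, ?_⟩
    rw [(hi z hz').2]; exact hz
  · intro c hc
    simp only [Finset.coe_filter, Set.mem_ofPred_eq, Finset.mem_range] at hc
    show ((y + c) % n + (n - y)) % n = c
    rw [Nat.mod_add_mod, show y + c + (n - y) = c + n by omega, Nat.add_mod_right,
      Nat.mod_eq_of_lt hc.1]
  · intro z hz
    exact (hi z (Finset.mem_range.1 (hG hz))).2

/-- No system of `s+1` pairwise far representatives. -/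
def NM (n k s : ℕ) (G : ℕ → Finset ℕ) : Prop :=
  ¬ ∃ x : ℕ → ℕ, (∀ i ≤ s, x i ∈ G i) ∧ ∀ i j, i < j → j ≤ s → Far n k (x i) (x j)

lemma circ_base (k s n : ℕ) (hk : 0 < k) (hn : n = (s + 1) * k)
    (G : ℕ → Finset ℕ) (hG : ∀ i, G i ⊆ Finset.range n) (hNM : NM n k s G) :
    ∑ i ∈ Finset.range (s + 1), (G i).card ≤ s * n := by
  have hik : ∀ i, i < s + 1 → i * k + k ≤ n := by
    intro i hi
    rw [hn, ← Nat.succ_mul]; exact Nat.mul_le_mul_right _ hi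
  have h1 : ∀ i ∈ Finset.range (s + 1), (G i).card
      = ∑ c ∈ Finset.range n, if (i * k + c) % n ∈ G i then 1 else 0 := by
    intro i hi
    have := hik i (Finset.mem_range.1 hi)
    rw [← Finset.card_filter, rot_card n (i * k) (by omega) _ (hG i)]
  rw [Finset.sum_congr rfl h1, Finset.sum_comm]
  have h2 : ∀ c ∈ Finset.range n, (∑ i ∈ Finset.range (s + 1),
      if (i * k + c) % n ∈ G i then 1 else 0) ≤ s := by
    intro c hc
    rw [← Finset.card_filter]
    by_contra hcon
    push Not at hcon
    have h3 : (Finset.range (s + 1)).filter (fun i => (i * k + c) % n ∈ G i)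
        = Finset.range (s + 1) := by
      apply Finset.eq_of_subset_of_card_le (Finset.filter_subset _ _)
      rw [Finset.card_range]; omega
    apply hNM
    refine ⟨fun i => (i * k + c) % n, ?_, ?_⟩
    · intro i hi
      have : i ∈ (Finset.range (s + 1)).filter (fun i => (i * k + c) % n ∈ G i) := by
        rw [h3]; exact Finset.mem_range.2 (by omega)
      exact (Finset.mem_filter.1 this).2
    · intro i j hij hj
      have ha := hik i (by omega)
      have hb := hik j (by omega)
      have hab : i * k + k ≤ j * k := by
        rw [← Nat.succ_mul]; exact Nat.mul_le_mul_right _ hij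
      apply Far.rot _ (by omega) (by omega) (Finset.mem_range.1 hc)
      left; omega
  calc _ ≤ ∑ c ∈ Finset.range n, s := Finset.sum_le_sum h2
    _ = s * n := by simp [mul_comm]

lemma NM_rot (n k s : ℕ) (G : ℕ → Finset ℕ) (hNM : NM n k s G) (c : ℕ) (hc : c < n) :
    NM n k s (fun i => (Finset.range n).filter (fun y => (y + c) % n ∈ G i)) := by
  rintro ⟨x, hx, hf⟩
  apply hNM
  simp only [Finset.mem_filter, Finset.mem_range] at hx
  exact ⟨fun i => (x i + c) % n, fun i hi => (hx i hi).2, fun i j hij hj =>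
    (hf i j hij hj).rot (hx i (by omega)).1 (hx j hj).1 hc⟩

lemma circ_full (k s n : ℕ) (hk : 0 < k) (hn : (s + 2) * k ≤ n)
    (G : ℕ → Finset ℕ) (hG0 : G 0 = Finset.range n) (hNM : NM n k (s + 1) G) :
    NM (n - k) k s (fun i => (Finset.range (n - k)).filter (fun y => y ∈ G (i + 1))) := by
  rintro ⟨y, hy, hf⟩
  simp only [Finset.mem_filter, Finset.mem_range] at hy
  have hn2 : 2 * k ≤ n := le_trans (Nat.mul_le_mul_right _ (by omega)) hn
  obtain ⟨M, hM, hmax⟩ := Finset.exists_max_image (Finset.range (s + 1)) y ⟨0, by simp⟩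
  simp only [Finset.mem_range] at hM hmax
  have hyM := (hy M (by omega)).1
  apply hNM
  refine ⟨fun i => if i = 0 then (y M + k) % n else y (i - 1), ?_, ?_⟩
  · intro i hi
    rcases i with _ | i
    · simp only [if_true, hG0, Finset.mem_range]; exact Nat.mod_lt _ (by omega)
    · simpa using (hy i (by omega)).2
  · intro i j hij hj
    obtain ⟨j, rfl⟩ : ∃ jj, j = jj + 1 := ⟨j - 1, by omega⟩
    rcases i with _ | i
    · simp only [if_true, Nat.add_sub_cancel, Nat.succ_ne_zero, if_false]
      rw [Nat.mod_eq_of_lt (by omega)]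
      have h1 := hmax j (by omega)
      have h2 := (hy j (by omega)).1
      rcases lt_trichotomy j M with h | h | h
      · have := hf j M h (by omega)
        unfold Far at *; omega
      · subst h; unfold Far; omega
      · have := hf M j h (by omega)
        unfold Far at *; omega
    · simp only [Nat.add_sub_cancel, Nat.succ_ne_zero, if_false]
      have := hf i j (by omega) (by omega)
      unfold Far at *; omega

lemma circ (k : ℕ) (hk : 0 < k) : ∀ s n : ℕ, (s + 1) * k ≤ n → ∀ G : ℕ → Finset ℕ,
    (∀ i, G i ⊆ Finset.range n) → (∀ i, G (i + 1) ⊆ G i) → NM n k s G →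
    (k : ℤ) * ∑ i ∈ Finset.range s, ((G i).card : ℤ) + ((n : ℤ) - s * k) * (G s).card
      ≤ s * k * n := by
  intro s
  induction s with
  | zero =>
    intro n hn G hG hA hNM
    have : G 0 = ∅ := by
      rw [Finset.eq_empty_iff_forall_notMem]
      intro x hx
      apply hNM
      refine ⟨fun _ => x, ?_, ?_⟩
      · intro i hi
        obtain rfl : i = 0 := by omega
        exact hx
      · intro i j h1 h2; omega
    simp [this]
  | succ s ihs =>
    intro n hn
    induction n, hn using Nat.le_induction with
    | base =>
      intro G hG hA hNM
      have := circ_base k (s + 1) _ hk rfl G hG hNM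
      rw [Finset.sum_range_succ] at this
      zify at this
      push_cast
      nlinarith [mul_le_mul_of_nonneg_left this (by positivity : (0 : ℤ) ≤ k)]
    | succ n hn ihn =>
      intro G hG hA hNM
      by_cases h0 : G 0 = Finset.range (n + 1)
      · -- the full case
        have hn' : (s + 2) * k ≤ n + 1 := by
          have : (s + 2) * k = (s + 1 + 1) * k := by ring
          omega
        have hkn : k + (s + 1) * k = (s + 2) * k := by ring
        have hpos : 0 < (s + 1) * k := by positivity
        set N := n + 1 with hN
        let H : ℕ → ℕ → Finset ℕ := fun c i =>
          (Finset.range (N - k)).filter (fun y => (y + c) % N ∈ G (i + 1))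
        have hH : ∀ c ∈ Finset.range N,
            (k : ℤ) * ∑ i ∈ Finset.range s, ((H c i).card : ℤ)
              + (((N - k : ℕ) : ℤ) - s * k) * (H c s).card ≤ s * k * (N - k : ℕ) := by
          intro c hc
          rw [Finset.mem_range] at hc
          apply ihs (N - k) (by omega) (H c)
          · intro i; exact Finset.filter_subset _ _
          · intro i y hy
            simp only [H, Finset.mem_filter] at hy ⊢
            exact ⟨hy.1, hA _ hy.2⟩
          · have h1 := NM_rot N k (s + 1) G hNM c hc
            have h2 := circ_full k s N hk hn' _ (by
              ext y
              simp only [Finset.mem_filter, Finset.mem_range, h0]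
              exact ⟨fun h => h.1, fun h => ⟨h, Nat.mod_lt _ (by omega)⟩⟩) h1
            convert h2 using 2
            ext y
            simp only [H, Finset.mem_filter, Finset.mem_range]
            constructor
            · rintro ⟨h3, h4⟩; exact ⟨h3, by omega, h4⟩
            · rintro ⟨h3, _, h4⟩; exact ⟨h3, h4⟩
        have hcount : ∀ i, ∑ c ∈ Finset.range N, ((H c i).card : ℤ)
            = ((N - k : ℕ) : ℤ) * (G (i + 1)).card := by
          intro i
          have : ∑ c ∈ Finset.range N, (H c i).card = (N - k) * (G (i + 1)).card := by
            simp only [H, Finset.card_filter]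
            rw [Finset.sum_comm]
            rw [Finset.sum_congr rfl (g := fun _ => (G (i + 1)).card)]
            · simp
            · intro y hy
              rw [Finset.mem_range] at hy
              rw [← Finset.card_filter, rot_card N y (by omega) _ (hG _)]
          exact_mod_cast this
        have hsum := Finset.sum_le_sum hH
        rw [Finset.sum_add_distrib, ← Finset.mul_sum, ← Finset.mul_sum, Finset.sum_comm,
          Finset.sum_congr rfl (fun i _ => hcount i), hcount, ← Finset.mul_sum] at hsum
        simp only [Finset.sum_const, Finset.card_range, nsmul_eq_mul] at hsum
        have hP : (0 : ℤ) < ((N - k : ℕ) : ℤ) := by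
          have : 0 < N - k := by omega
          exact_mod_cast this
        have hcast : ((N - k : ℕ) : ℤ) = N - k := by
          rw [Nat.cast_sub (by omega)]
        rw [Finset.sum_range_succ', h0, Finset.card_range]
        have key : (k : ℤ) * ∑ i ∈ Finset.range s, ((G (i + 1)).card : ℤ)
            + (((N - k : ℕ) : ℤ) - s * k) * (G (s + 1)).card ≤ s * k * N := by
          refine le_of_mul_le_mul_left ?_ hP
          linarith
        rw [hcast] at key
        push_cast at key ⊢
        linarith
      · -- a point is missing
        obtain ⟨p, hp, hpG⟩ : ∃ p, p < n + 1 ∧ p ∉ G 0 := by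
          by_contra hcon
          push Not at hcon
          apply h0
          apply Finset.Subset.antisymm (hG 0)
          intro p hp
          exact hcon p (Finset.mem_range.1 hp)
        have hA0 : ∀ i, G i ⊆ G 0 := by
          intro i
          induction i with
          | zero => exact Finset.Subset.refl _
          | succ i ih => exact (hA i).trans ih
        -- rotation amount: n + c = p mod (n+1)
        obtain ⟨c, hc, hcp⟩ : ∃ c, c < n + 1 ∧ (n + c) % (n + 1) = p := by
          by_cases hpn : p = n
          · exact ⟨0, by omega, by rw [Nat.mod_eq_of_lt] <;> omega⟩
          · refine ⟨p + 1, by omega, ?_⟩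
            rw [show n + (p + 1) = p + (n + 1) by ring, Nat.add_mod_right, Nat.mod_eq_of_lt hp]
        let H : ℕ → Finset ℕ := fun i =>
          (Finset.range (n + 1)).filter (fun y => (y + c) % (n + 1) ∈ G i)
        have hHc : ∀ i, (H i).card = (G i).card := by
          intro i
          rw [← rot_card (n + 1) c hc (G i) (hG i)]
          simp only [H, add_comm]
        have hHs : ∀ i, H i ⊆ Finset.range n := by
          intro i y hy
          simp only [H, Finset.mem_filter, Finset.mem_range] at hy ⊢
          by_contra hcon
          obtain rfl : y = n := by omega
          rw [hcp] at hy
          exact hpG (hA0 i hy.2)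
        have hHA : ∀ i, H (i + 1) ⊆ H i := by
          intro i y hy
          simp only [H, Finset.mem_filter] at hy ⊢
          exact ⟨hy.1, hA _ hy.2⟩
        have hHA' : ∀ i j, i ≤ j → H j ⊆ H i := by
          intro i j hij
          induction j, hij using Nat.le_induction with
          | base => exact Finset.Subset.refl _
          | succ j _ ih => exact (hHA j).trans ih
        have hHN : NM n k (s + 1) H := by
          rintro ⟨x, hx, hf⟩
          apply NM_rot (n + 1) k (s + 1) G hNM c hc
          refine ⟨x, hx, fun i j hij hj => ?_⟩
          have := hf i j hij hj
          unfold Far at *; omega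
        have e1 := ihn H hHs hHA hHN
        have e2 := ihn (fun _ => H (s + 1)) (fun _ => hHs _) (fun _ => Finset.Subset.refl _) (by
          rintro ⟨x, hx, hf⟩
          exact hHN ⟨x, fun i hi => hHA' i (s + 1) hi (hx i hi), hf⟩)
        simp only [hHc, Finset.sum_const, Finset.card_range, nsmul_eq_mul] at e1 e2
        have hnpos : (0 : ℤ) < n := by
          have : 0 < (s + 1 + 1) * k := by positivity
          have : 0 < n := by omega
          exact_mod_cast this
        have e3 : ((G (s + 1)).card : ℤ) ≤ (s + 1) * k := by
          refine le_of_mul_le_mul_left ?_ hnpos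
          push_cast at e2
          linarith
        push_cast at e1 ⊢
        linarith

/-- Greedy choice of distinct representatives. -/
lemma greedy {α : Type*} [DecidableEq α] [Nonempty α] (D : ℕ → Finset α) : ∀ s : ℕ,
    (∀ j < s, j + 1 ≤ (D j).card) →
    ∃ f : ℕ → α, (∀ j < s, f j ∈ D j) ∧ ∀ i j, i < j → j < s → f i ≠ f j := by
  intro s
  induction s with
  | zero => intro _; exact ⟨fun _ => Classical.arbitrary α, by omega, by omega⟩
  | succ s ih =>
    intro h
    obtain ⟨f, hf, hi⟩ := ih (fun j hj => h j (by omega))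
    have : ∃ a ∈ D s, a ∉ (Finset.range s).image f := by
      apply Finset.exists_mem_notMem_of_card_lt_card
      have := h s (by omega)
      have h2 : ((Finset.range s).image f).card ≤ s := by
        simpa using Finset.card_image_le (s := Finset.range s) (f := f)
      omega
    obtain ⟨a, ha, han⟩ := this
    refine ⟨fun j => if j = s then a else f j, ?_, ?_⟩
    · intro j hj
      by_cases h1 : j = s
      · subst h1; simpa using ha
      · simpa [h1] using hf j (by omega)
    · intro i j hij hj
      have hi1 : i ≠ s := by omega
      by_cases h1 : j = s
      · simp only [hi1, h1, if_true, if_false]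
        intro h2
        exact han (Finset.mem_image.2 ⟨i, Finset.mem_range.2 (by omega), h2⟩)
      · simp only [hi1, h1, if_false]
        exact hi i j hij (by omega)

/-- Arc of length `k` starting at `c`. -/
def arc (n k c : ℕ) : Finset (Fin n) :=
  Finset.univ.filter (fun x => (c ≤ x.val ∧ x.val < c + k) ∨ x.val + n < c + k)

lemma arc_card (n k c : ℕ) (hk : k ≤ n) (hc : c < n) : (arc n k c).card = k := by
  rw [← Finset.card_map Fin.valEmbedding]
  have : (arc n k c).map Fin.valEmbedding
      = Finset.Ico c (min (c + k) n) ∪ Finset.range (c + k - n) := by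
    ext y
    simp only [arc, Finset.mem_map, Finset.mem_filter, Finset.mem_univ, true_and,
      Fin.valEmbedding_apply, Finset.mem_union, Finset.mem_Ico, Finset.mem_range]
    constructor
    · rintro ⟨x, hx, rfl⟩
      have := x.isLt
      omega
    · intro h
      exact ⟨⟨y, by omega⟩, by simp only; omega, rfl⟩
  rw [this, Finset.card_union_of_disjoint]
  · simp only [Nat.card_Ico, Finset.card_range]; omega
  · rw [Finset.disjoint_left]
    intro y h1 h2
    simp only [Finset.mem_Ico, Finset.mem_range] at h1 h2
    omega

lemma arc_disj (n k a b : ℕ) (ha : a < n) (hb : b < n) (h : Far n k a b) : Disjoint (arc n k a) (arc n k b) := by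
  rw [Finset.disjoint_left]
  intro x h1 h2
  have := x.isLt
  simp only [arc, Finset.mem_filter, Finset.mem_univ, true_and] at h1 h2
  unfold Far at h
  omega

/-- Averaging over permutations. -/
lemma perm_avg (n k : ℕ) (d : Finset (Fin n) → ℕ) (B : Finset (Fin n)) (hB : B.card = k) :
    n.choose k * ∑ π : Equiv.Perm (Fin n), d (B.map π.toEmbedding)
      = n.factorial * ∑ A ∈ Finset.powersetCard k Finset.univ, d A := by
  have h1 : ∀ A ∈ Finset.powersetCard k (Finset.univ : Finset (Fin n)),
      ∑ π : Equiv.Perm (Fin n), d (A.map π.toEmbedding)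
        = ∑ π : Equiv.Perm (Fin n), d (B.map π.toEmbedding) := by
    intro A hA
    have hA' := (Finset.mem_powersetCard.1 hA).2
    let e : {x // x ∈ B} ≃ {x // x ∈ A} := Finset.equivOfCardEq (by omega)
    let τ : Equiv.Perm (Fin n) := e.extendSubtype
    have hτ : B.map τ.toEmbedding = A := by
      apply Finset.eq_of_subset_of_card_le
      · intro x hx
        obtain ⟨y, hy, rfl⟩ := Finset.mem_map.1 hx
        exact e.extendSubtype_mem y hy
      · rw [Finset.card_map]; omega
    rw [← hτ]
    refine Fintype.sum_equiv (Equiv.mulRight τ) _ _ ?_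
    intro π
    rw [Finset.map_map]
    rfl
  have h2 : ∀ π : Equiv.Perm (Fin n),
      ∑ A ∈ Finset.powersetCard k (Finset.univ : Finset (Fin n)), d (A.map π.toEmbedding)
        = ∑ A ∈ Finset.powersetCard k Finset.univ, d A := by
    intro π
    refine Finset.sum_nbij' (fun A => A.map π.toEmbedding) (fun A => A.map π.symm.toEmbedding)
      ?_ ?_ ?_ ?_ ?_
    · intro A hA; simpa [Finset.mem_powersetCard] using hA
    · intro A hA; simpa [Finset.mem_powersetCard] using hA
    · intro A _; ext x; simp [Finset.map_map]
    · intro A _; ext x; simp [Finset.map_map]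
    · intro A _; rfl
  have h3 := Finset.sum_congr rfl h1
  rw [Finset.sum_comm, Finset.sum_congr rfl (fun π _ => h2 π)] at h3
  simp only [Finset.sum_const, Finset.card_powersetCard, Finset.card_univ, smul_eq_mul,
    Fintype.card_perm, Fintype.card_fin] at h3
  exact h3.symm

lemma arith (k s n m S g : ℤ) (hk : 0 < k) (hn : 0 < n) (hsm : s ≤ m) (hg0 : 0 ≤ g)
    (h : k * S + (n - s * k) * g ≤ s * k * n) (hg : g ≤ s * k) :
    S + (m - s) * g ≤ max (s * n) (m * s * k) := by
  by_cases hc : k * m ≤ n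
  · apply le_max_of_le_left
    refine le_of_mul_le_mul_left ?_ hk
    nlinarith [mul_nonneg (sub_nonneg.2 hc) hg0]
  · apply le_max_of_le_right
    push Not at hc
    refine le_of_mul_le_mul_left ?_ hk
    nlinarith [mul_nonneg (sub_nonneg.2 hc.le) (sub_nonneg.2 hg)]

theorem stmt16 (n k s m : ℕ) (hs : 0 < s) (hk : 0 < k)
    (hn : (s + 1) * k ≤ n) (hm : s + 1 ≤ m)
    (F : Fin m → Finset (Finset (Fin n))) (hF : ∀ i, ∀ A ∈ F i, A.card = k)
    (hover : ¬ ∃ (T : Finset (Fin m)) (e : Fin m → Finset (Fin n)),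
      T.card = s + 1 ∧ (∀ t ∈ T, e t ∈ F t) ∧
      (↑T : Set (Fin m)).Pairwise (fun a b => Disjoint (e a) (e b))) :
    ∑ i, (F i).card ≤ max (s * n.choose k) (m * s * (n - 1).choose (k - 1)) := by
  classical
  have hkn : k ≤ n := le_trans (Nat.le_mul_of_pos_left _ (by omega)) hn
  have hn0 : 0 < n := by omega
  haveI : Nonempty (Fin m) := ⟨⟨0, by omega⟩⟩
  let D : Finset (Fin n) → Finset (Fin m) := fun A => Finset.univ.filter (fun i => A ∈ F i)
  -- no disjoint system of sets of degrees at least 1, ..., s+1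
  have hD : ¬ ∃ A : ℕ → Finset (Fin n), (∀ j < s + 1, j + 1 ≤ (D (A j)).card) ∧
      ∀ i j, i < j → j < s + 1 → Disjoint (A i) (A j) := by
    rintro ⟨A, hA, hdis⟩
    obtain ⟨f, hf, hinj⟩ := greedy (fun j => D (A j)) (s + 1) hA
    have hinjOn : Set.InjOn f (Finset.range (s + 1)) := by
      intro a ha b hb hab
      simp only [Finset.coe_range, Set.mem_Iio] at ha hb
      rcases lt_trichotomy a b with h | h | h
      · exact absurd hab (hinj a b h hb)
      · exact h
      · exact absurd hab.symm (hinj b a h ha)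
    have hleft : ∀ j < s + 1, Function.invFunOn f (Finset.range (s + 1)) (f j) = j := by
      intro j hj
      exact hinjOn.leftInvOn_invFunOn (by simpa using hj)
    apply hover
    refine ⟨(Finset.range (s + 1)).image f,
      fun t => A (Function.invFunOn f (Finset.range (s + 1)) t), ?_, ?_, ?_⟩
    · rw [Finset.card_image_of_injOn hinjOn, Finset.card_range]
    · intro t ht
      obtain ⟨j, hj, rfl⟩ := Finset.mem_image.1 ht
      rw [Finset.mem_range] at hj
      show A _ ∈ _
      rw [hleft j hj]
      exact (Finset.mem_filter.1 (hf j hj)).2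
    · intro t ht u hu htu
      obtain ⟨i, hi, rfl⟩ := Finset.mem_image.1 (Finset.mem_coe.1 ht)
      obtain ⟨j, hj, rfl⟩ := Finset.mem_image.1 (Finset.mem_coe.1 hu)
      rw [Finset.mem_range] at hi hj
      show Disjoint (A _) (A _)
      rw [hleft i hi, hleft j hj]
      rcases lt_trichotomy i j with h | h | h
      · exact hdis i j h hj
      · subst h; exact absurd rfl htu
      · exact (hdis j i h hi).symm
  -- bound on each cyclic arrangement
  have hperm : ∀ π : Equiv.Perm (Fin n),
      ∑ c ∈ Finset.range n, (D ((arc n k c).map π.toEmbedding)).card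
        ≤ max (s * n) (m * s * k) := by
    intro π
    let dd : ℕ → ℕ := fun c => (D ((arc n k c).map π.toEmbedding)).card
    have hdd : ∀ c, dd c ≤ m := fun c => by
      simpa using Finset.card_le_univ (D ((arc n k c).map π.toEmbedding))
    let G : ℕ → Finset ℕ := fun j => (Finset.range n).filter (fun c => j + 1 ≤ dd c)
    have hGs : ∀ j, G j ⊆ Finset.range n := fun j => Finset.filter_subset _ _
    have hGA' : ∀ i j, i ≤ j → G j ⊆ G i := by
      intro i j hij c hc
      simp only [G, Finset.mem_filter] at hc ⊢
      exact ⟨hc.1, by omega⟩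
    have hNM : NM n k s G := by
      rintro ⟨x, hx, hf⟩
      apply hD
      refine ⟨fun j => (arc n k (x j)).map π.toEmbedding, ?_, ?_⟩
      · intro j hj
        exact (Finset.mem_filter.1 (hx j (by omega))).2
      · intro i j hij hj
        rw [Finset.disjoint_map]
        exact arc_disj _ _ _ _ (Finset.mem_range.1 (hGs i (hx i (by omega))))
          (Finset.mem_range.1 (hGs j (hx j (by omega)))) (hf i j hij (by omega))
    have e1 := circ k hk s n hn G hGs (fun i => hGA' _ _ (by omega)) hNM
    have e2 := circ k hk s n hn (fun _ => G s) (fun _ => hGs _) (fun _ => Finset.Subset.refl _) (by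
      rintro ⟨x, hx, hf⟩
      exact hNM ⟨x, fun i hi => hGA' i s hi (hx i hi), hf⟩)
    simp only [Finset.sum_const, Finset.card_range, nsmul_eq_mul] at e2
    have hnz : (0 : ℤ) < n := by exact_mod_cast hn0
    have e3 : ((G s).card : ℤ) ≤ s * k := by
      refine le_of_mul_le_mul_left ?_ hnz
      linarith
    have e4 : ∑ c ∈ Finset.range n, dd c = ∑ j ∈ Finset.range m, (G j).card := by
      simp only [G, Finset.card_filter]
      rw [Finset.sum_comm]
      refine Finset.sum_congr rfl (fun c _ => ?_)
      rw [← Finset.card_filter]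
      have : (Finset.range m).filter (fun j => j + 1 ≤ dd c) = Finset.range (dd c) := by
        ext j
        have := hdd c
        simp only [Finset.mem_filter, Finset.mem_range]
        omega
      rw [this, Finset.card_range]
    have e5 : ∑ j ∈ Finset.range m, (G j).card
        ≤ ∑ j ∈ Finset.range s, (G j).card + (m - s) * (G s).card := by
      rw [← Finset.sum_range_add_sum_Ico _ (show s ≤ m by omega)]
      apply Nat.add_le_add_left
      calc _ ≤ ∑ j ∈ Finset.Ico s m, (G s).card :=
            Finset.sum_le_sum (fun j hj => Finset.card_le_card (hGA' _ _ (Finset.mem_Ico.1 hj).1))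
        _ = _ := by simp
    have e6 := arith k s n m (∑ j ∈ Finset.range s, ((G j).card : ℤ)) (G s).card
      (by exact_mod_cast hk) hnz (by exact_mod_cast (show s ≤ m by omega)) (by positivity) e1 e3
    show ∑ c ∈ Finset.range n, dd c ≤ _
    rw [e4]
    refine e5.trans ?_
    zify
    rw [Nat.cast_sub (by omega)]
    exact e6
  -- total
  have htot : ∑ i, (F i).card
      = ∑ A ∈ Finset.powersetCard k (Finset.univ : Finset (Fin n)), (D A).card := by
    simp only [D, Finset.card_filter]
    rw [Finset.sum_comm]
    refine Finset.sum_congr rfl (fun i _ => ?_)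
    rw [← Finset.card_filter]
    congr 1
    ext A
    simp only [Finset.mem_filter, Finset.mem_powersetCard, Finset.subset_univ, true_and]
    exact ⟨fun h => ⟨hF i A h, h⟩, fun h => h.2⟩
  have hsum := Finset.sum_le_sum (fun π (_ : π ∈ (Finset.univ : Finset (Equiv.Perm (Fin n)))) =>
    hperm π)
  rw [Finset.sum_comm] at hsum
  have hsum2 := Nat.mul_le_mul_left (n.choose k) hsum
  rw [Finset.mul_sum, Finset.sum_congr rfl (fun c hc => perm_avg n k (fun A => (D A).card)
    (arc n k c) (arc_card n k c hkn (Finset.mem_range.1 hc))), ← htot] at hsum2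
  simp only [Finset.sum_const, Finset.card_range, Finset.card_univ, smul_eq_mul,
    Fintype.card_perm, Fintype.card_fin] at hsum2
  have hfin : n * ∑ i, (F i).card ≤ n.choose k * max (s * n) (m * s * k) := by
    refine Nat.le_of_mul_le_mul_left ?_ (Nat.factorial_pos n)
    calc _ = n * (n.factorial * ∑ i, (F i).card) := by ring
      _ ≤ _ := hsum2
      _ = _ := by ring
  have hch : n.choose k * k = n * (n - 1).choose (k - 1) := by
    have := Nat.add_one_mul_choose_eq (n - 1) (k - 1)
    rw [show n - 1 + 1 = n by omega, show k - 1 + 1 = k by omega] at this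
    exact this.symm
  refine Nat.le_of_mul_le_mul_left (hfin.trans (le_of_eq ?_)) hn0
  rw [mul_max_of_nonneg _ _ (Nat.zero_le _), mul_max_of_nonneg _ _ (Nat.zero_le _)]
  congr 1
  · ring
  · calc n.choose k * (m * s * k) = m * s * (n.choose k * k) := by ring
      _ = _ := by rw [hch]; ring
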